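/- arXiv:1902.08582 — 2 statements merged into one kernel-verified Lean document; each statement's English description precedes it below -/
import Mathlib

section
/- Let ρ = e^{−V} be a probability density on ℝⁿ with V : ℝⁿ → ℝ convex, and for δ > 0 let m_δ be the unique point satisfying ∫ x e^{−δ|x−m_δ|²/2} ρ(x) dx = m_δ ∫ e^{−δ|x−m_δ|²/2} ρ(x) dx. Then for every δ > 0, −log( ∫_{ℝⁿ} e^{−δ|x−m_δ|²/2} ρ(x) dx ) ≤ (δ/2)·Var(ρ). -/
open MeasureTheory

open scoped ENNReal Pointwise

/-- One-dimensional Brunn–Minkowski for compact sets. -/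
lemma IsCompact.volume_add_volume_le {A B : Set ℝ} (hA : IsCompact A) (hB : IsCompact B)
    (hA' : A.Nonempty) (hB' : B.Nonempty) : volume A + volume B ≤ volume (A + B) := by
  obtain ⟨a, ha, hmax⟩ := hA.exists_isGreatest hA'
  obtain ⟨b, hb, hmin⟩ := hB.exists_isLeast hB'
  have hnull : volume ((b +ᵥ A) ∩ (a +ᵥ B)) = 0 := by
    refine measure_mono_null (t := {a + b}) ?_ (measure_singleton _)
    rintro _ ⟨⟨x, hx, rfl⟩, ⟨y, hy, hxy⟩⟩
    have h1 := hmax hx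
    have h2 := hmin hy
    simp only [vadd_eq_add, Set.mem_singleton_iff] at hxy ⊢
    linarith
  have hm : MeasurableSet (a +ᵥ B) := hB.measurableSet.const_vadd a
  calc volume A + volume B = volume (b +ᵥ A) + volume (a +ᵥ B) := by
        rw [measure_vadd, measure_vadd]
    _ = volume ((b +ᵥ A) ∪ (a +ᵥ B)) := by
        rw [← measure_union_add_inter _ hm, hnull, add_zero]
    _ ≤ volume (A + B) := by
        refine measure_mono (Set.union_subset ?_ ?_)
        · rintro _ ⟨x, hx, rfl⟩
          exact ⟨x, hx, b, hb, add_comm _ _⟩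
        · rintro _ ⟨y, hy, rfl⟩
          exact ⟨a, ha, y, hy, rfl⟩

/-- One-dimensional Brunn–Minkowski for measurable sets. -/
lemma MeasurableSet.volume_add_volume_le {A B : Set ℝ} (hA : MeasurableSet A)
    (hB : MeasurableSet B) (hA' : A.Nonempty) (hB' : B.Nonempty) :
    volume A + volume B ≤ volume (A + B) := by
  have key : ∀ {K : Set ℝ}, IsCompact K → K.Nonempty → K ⊆ A →
      volume K + volume B ≤ volume (A + B) := by
    intro K hK hK' hKA
    rw [hB.measure_eq_iSup_isCompact, ENNReal.add_iSup]
    refine iSup_le fun L => ?_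
    rw [iSup_and']
    by_cases hL : L ⊆ B ∧ IsCompact L
    · rw [ciSup_pos hL]
      rcases L.eq_empty_or_nonempty with rfl | hL'
      · obtain ⟨b, hb⟩ := hB'
        rw [measure_empty, add_zero, ← measure_vadd volume b K]
        refine measure_mono ?_
        rintro _ ⟨x, hx, rfl⟩
        exact ⟨x, hKA hx, b, hb, add_comm _ _⟩
      · exact (hK.volume_add_volume_le hL.2 hK' hL').trans
          (measure_mono (Set.add_subset_add hKA hL.1))
    · obtain ⟨b, hb⟩ := hB'
      simp only [hL, iSup_false, bot_eq_zero, add_zero]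
      rw [← measure_vadd volume b K]
      refine measure_mono ?_
      rintro _ ⟨x, hx, rfl⟩
      exact ⟨x, hKA hx, b, hb, add_comm _ _⟩
  obtain ⟨a, ha⟩ := hA'
  have h0 : volume B ≤ volume (A + B) := by
    simpa using key (isCompact_singleton (x := a)) (Set.singleton_nonempty a) (by simpa using ha)
  rw [hA.measure_eq_iSup_isCompact, ENNReal.iSup_add]
  refine iSup_le fun K => ?_
  rw [iSup_and']
  by_cases hK : K ⊆ A ∧ IsCompact K
  · rw [ciSup_pos hK]
    rcases K.eq_empty_or_nonempty with rfl | hK'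
    · simpa using h0
    · exact key hK.2 hK' hK.1
  · simpa [hK] using h0

lemma lintegral_eq_lintegral_meas_ofReal_lt {α : Type*} [MeasurableSpace α] (μ : Measure α)
    [SFinite μ] {f : α → ℝ≥0∞} (hf : Measurable f) :
    ∫⁻ x, f x ∂μ = ∫⁻ t in Set.Ioi (0 : ℝ), μ {x | ENNReal.ofReal t < f x} := by
  have h1 : ∀ c : ℝ≥0∞, c = ∫⁻ t in Set.Ioi (0 : ℝ), {t | ENNReal.ofReal t < c}.indicator 1 t := by
    intro c
    rw [lintegral_indicator_one (measurableSet_lt (by fun_prop) measurable_const),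
      Measure.restrict_apply (measurableSet_lt (by fun_prop) measurable_const)]
    rcases eq_or_ne c ⊤ with rfl | hc
    · simp
    · have : {t | ENNReal.ofReal t < c} ∩ Set.Ioi (0 : ℝ) = Set.Ioo 0 c.toReal := by
        ext t
        simp only [Set.mem_inter_iff, Set.mem_ofPred_eq, Set.mem_Ioi, Set.mem_Ioo]
        constructor
        · rintro ⟨h, h0⟩
          exact ⟨h0, (ENNReal.ofReal_lt_iff_lt_toReal h0.le hc).1 h⟩
        · rintro ⟨h0, h⟩
          exact ⟨(ENNReal.ofReal_lt_iff_lt_toReal h0.le hc).2 h, h0⟩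
      rw [this, Real.volume_Ioo, sub_zero, ENNReal.ofReal_toReal hc]
  have hS : MeasurableSet {p : α × ℝ | ENNReal.ofReal p.2 < f p.1} :=
    measurableSet_lt (by fun_prop) (by fun_prop)
  calc ∫⁻ x, f x ∂μ
      = ∫⁻ x, (∫⁻ t in Set.Ioi (0 : ℝ),
          {p : α × ℝ | ENNReal.ofReal p.2 < f p.1}.indicator 1 (x, t)) ∂μ :=
        lintegral_congr fun x => h1 (f x)
    _ = ∫⁻ t in Set.Ioi (0 : ℝ), ∫⁻ x,
          {p : α × ℝ | ENNReal.ofReal p.2 < f p.1}.indicator 1 (x, t) ∂μ :=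
        lintegral_lintegral_swap (f := fun x t =>
          {p : α × ℝ | ENNReal.ofReal p.2 < f p.1}.indicator 1 (x, t))
          (measurable_one.indicator hS).aemeasurable
    _ = _ := by
        refine lintegral_congr fun t => ?_
        exact lintegral_indicator_one (s := {x | ENNReal.ofReal t < f x})
          (measurableSet_lt measurable_const hf)

lemma ENNReal.four_mul_mul_le_add_sq (x y : ℝ≥0∞) : 4 * (x * y) ≤ (x + y) ^ 2 := by
  wlog h : x ≤ y generalizing x y
  · rw [mul_comm x, add_comm x]
    exact this y x (le_of_not_ge h)
  obtain ⟨d, rfl⟩ := exists_add_of_le h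
  calc 4 * (x * (x + d)) ≤ 4 * (x * (x + d)) + d ^ 2 := le_self_add
    _ = _ := by ring

lemma prekopa_leindler_real_of_iSup_eq_one {f g h : ℝ → ℝ≥0∞} (hf : Measurable f)
    (hg : Measurable g) (hh : Measurable h) (hf1 : ⨆ x, f x = 1) (hg1 : ⨆ x, g x = 1)
    (H : ∀ x y, f x * g y ≤ h ((2⁻¹ : ℝ) • (x + y)) ^ 2) :
    (∫⁻ x, f x) * (∫⁻ x, g x) ≤ (∫⁻ x, h x) ^ 2 := by
  have hlevel : ∀ t ∈ Set.Ioi (0 : ℝ), volume {x | ENNReal.ofReal t < f x} +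
      volume {x | ENNReal.ofReal t < g x} ≤ 2 * volume {x | ENNReal.ofReal t < h x} := by
    intro t ht
    rcases lt_or_ge t 1 with ht1 | ht1
    · have ht1' : ENNReal.ofReal t < 1 := by simpa using ht1
      have hA : {x | ENNReal.ofReal t < f x}.Nonempty := by
        obtain ⟨x, hx⟩ := lt_iSup_iff.1 (hf1 ▸ ht1')
        exact ⟨x, hx⟩
      have hB : {x | ENNReal.ofReal t < g x}.Nonempty := by
        obtain ⟨x, hx⟩ := lt_iSup_iff.1 (hg1 ▸ ht1')
        exact ⟨x, hx⟩
      refine (MeasurableSet.volume_add_volume_le (measurableSet_lt measurable_const hf)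
        (measurableSet_lt measurable_const hg) hA hB).trans ?_
      have : (2 : ℝ≥0∞) * volume {x | ENNReal.ofReal t < h x} =
          volume ((2 : ℝ) • {x | ENNReal.ofReal t < h x}) := by
        simp [Measure.addHaar_smul]
      rw [this]
      refine measure_mono ?_
      rintro _ ⟨x, hx, y, hy, rfl⟩
      refine ⟨(2⁻¹ : ℝ) • (x + y), ?_, by simp⟩
      simp only [Set.mem_ofPred_eq] at hx hy ⊢
      by_contra! hcon
      have h1 := (ENNReal.mul_lt_mul hx hy).trans_le (H x y)
      rw [← sq] at h1
      exact absurd (pow_le_pow_left' hcon 2) (not_le.2 h1)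
    · have h1 : ∀ k : ℝ → ℝ≥0∞, ⨆ x, k x = 1 → {x | ENNReal.ofReal t < k x} = ∅ := by
        intro k hk
        ext x
        simp only [Set.mem_ofPred_eq, Set.mem_empty_iff_false, iff_false, not_lt]
        calc k x ≤ 1 := hk ▸ le_iSup k x
          _ ≤ _ := by simpa using ht1
      simp [h1 f hf1, h1 g hg1]
  have hsum : (∫⁻ x, f x) + (∫⁻ x, g x) ≤ 2 * ∫⁻ x, h x := by
    have hm : ∀ k : ℝ → ℝ≥0∞, Antitone fun t : ℝ => volume {x | ENNReal.ofReal t < k x} :=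
      fun k s t hst => measure_mono fun x hx => (ENNReal.ofReal_le_ofReal hst).trans_lt hx
    rw [lintegral_eq_lintegral_meas_ofReal_lt _ hf, lintegral_eq_lintegral_meas_ofReal_lt _ hg,
      lintegral_eq_lintegral_meas_ofReal_lt _ hh, ← lintegral_add_left (hm f).measurable,
      ← lintegral_const_mul _ (hm h).measurable]
    exact setLIntegral_mono' measurableSet_Ioi hlevel
  have h4 : 4 * ((∫⁻ x, f x) * (∫⁻ x, g x)) ≤ 4 * (∫⁻ x, h x) ^ 2 :=
    calc _ ≤ ((∫⁻ x, f x) + (∫⁻ x, g x)) ^ 2 := ENNReal.four_mul_mul_le_add_sq _ _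
      _ ≤ (2 * ∫⁻ x, h x) ^ 2 := pow_le_pow_left' hsum 2
      _ = _ := by ring
  exact (ENNReal.mul_le_mul_iff_right (by simp) (by simp)).1 h4

lemma prekopa_leindler_real_of_iSup_ne_top {f g h : ℝ → ℝ≥0∞} (hf : Measurable f)
    (hg : Measurable g) (hh : Measurable h) (hft : ⨆ x, f x ≠ ⊤) (hgt : ⨆ x, g x ≠ ⊤)
    (H : ∀ x y, f x * g y ≤ h ((2⁻¹ : ℝ) • (x + y)) ^ 2) :
    (∫⁻ x, f x) * (∫⁻ x, g x) ≤ (∫⁻ x, h x) ^ 2 := by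
  set a := ⨆ x, f x
  set b := ⨆ x, g x
  rcases eq_or_ne a 0 with ha | ha
  · have : ∀ x, f x = 0 := fun x => le_antisymm ((le_iSup f x).trans ha.le) zero_le
    simp [this]
  rcases eq_or_ne b 0 with hb | hb
  · have : ∀ x, g x = 0 := fun x => le_antisymm ((le_iSup g x).trans hb.le) zero_le
    simp [this]
  set c : ℝ≥0∞ := (a⁻¹ * b⁻¹) ^ (2⁻¹ : ℝ)
  have hc : c ^ 2 = a⁻¹ * b⁻¹ := by
    rw [← ENNReal.rpow_natCast, ← ENNReal.rpow_mul]
    simp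
  have key := prekopa_leindler_real_of_iSup_eq_one (f := fun x => a⁻¹ * f x)
    (g := fun x => b⁻¹ * g x) (h := fun x => c * h x) (hf.const_mul _) (hg.const_mul _)
    (hh.const_mul _) (by rw [← ENNReal.mul_iSup]; exact ENNReal.inv_mul_cancel ha hft)
    (by rw [← ENNReal.mul_iSup]; exact ENNReal.inv_mul_cancel hb hgt) (by
      intro x y
      rw [mul_pow, hc, mul_mul_mul_comm]
      exact mul_le_mul_right (H x y) _)
  rw [lintegral_const_mul _ hf, lintegral_const_mul _ hg, lintegral_const_mul _ hh, mul_pow, hc,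
    mul_mul_mul_comm] at key
  refine (ENNReal.mul_le_mul_iff_right ?_ ?_).1 key
  · simp [hft, hgt]
  · exact ENNReal.mul_ne_top (by simpa using ha) (by simpa using hb)

/-- The midpoint Prékopa–Leindler inequality on the real line. -/
lemma prekopa_leindler_real {f g h : ℝ → ℝ≥0∞} (hf : Measurable f)
    (hg : Measurable g) (hh : Measurable h)
    (H : ∀ x y, f x * g y ≤ h ((2⁻¹ : ℝ) • (x + y)) ^ 2) :
    (∫⁻ x, f x) * (∫⁻ x, g x) ≤ (∫⁻ x, h x) ^ 2 := by
  have htrunc : ∀ k : ℝ → ℝ≥0∞, Measurable k →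
      ∫⁻ x, k x = ⨆ N : ℕ, ∫⁻ x, min (k x) N := by
    intro k hk
    rw [← lintegral_iSup (fun N => hk.min measurable_const)
      (fun M N hMN x => min_le_min_left _ (by exact_mod_cast hMN))]
    refine lintegral_congr fun x => ?_
    rw [← inf_iSup_eq, ENNReal.iSup_natCast, inf_top_eq]
  have hbdd : ∀ (k : ℝ → ℝ≥0∞) (N : ℕ), ⨆ x, min (k x) (N : ℝ≥0∞) ≠ ⊤ := fun k N =>
    ne_top_of_le_ne_top (ENNReal.natCast_ne_top N) (iSup_le fun x => min_le_right _ _)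
  rw [htrunc f hf, htrunc g hg]
  simp_rw [ENNReal.iSup_mul, ENNReal.mul_iSup]
  refine iSup_le fun N => iSup_le fun M => ?_
  exact prekopa_leindler_real_of_iSup_ne_top (hf.min measurable_const) (hg.min measurable_const)
    hh (hbdd f N) (hbdd g M) fun x y =>
      (mul_le_mul' (min_le_left _ _) (min_le_left _ _)).trans (H x y)

lemma measurable_fin_cons {n : ℕ} :
    Measurable fun p : ℝ × (Fin n → ℝ) => (Fin.cons p.1 p.2 : Fin (n + 1) → ℝ) :=
  measurable_pi_iff.2 fun i => by
    refine Fin.cases ?_ (fun j => ?_) i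
    · simpa using measurable_fst
    · simpa [Function.comp_def] using (measurable_pi_apply j).comp measurable_snd

lemma lintegral_fin_cons {n : ℕ} {f : (Fin (n + 1) → ℝ) → ℝ≥0∞} (hf : Measurable f) :
    ∫⁻ x, f x = ∫⁻ s : ℝ, ∫⁻ z : Fin n → ℝ, f (Fin.cons s z) := by
  have e := (volume_preserving_piFinSuccAbove (fun _ : Fin (n + 1) => ℝ) 0).symm
  have hcons : ∀ p : ℝ × (Fin n → ℝ),
      (MeasurableEquiv.piFinSuccAbove (fun _ : Fin (n + 1) => ℝ) 0).symm p =
        Fin.cons p.1 p.2 := fun p => Fin.insertNth_zero' p.1 p.2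
  rw [← e.lintegral_comp hf]
  simp_rw [hcons]
  exact lintegral_prod (μ := volume) (ν := volume)
    (fun p : ℝ × (Fin n → ℝ) => f (Fin.cons p.1 p.2))
    (hf.comp measurable_fin_cons).aemeasurable

/-- The midpoint Prékopa–Leindler inequality on `Fin n → ℝ`. -/
lemma prekopa_leindler_pi {n : ℕ} {f g h : (Fin n → ℝ) → ℝ≥0∞} (hf : Measurable f)
    (hg : Measurable g) (hh : Measurable h)
    (H : ∀ x y, f x * g y ≤ h ((2⁻¹ : ℝ) • (x + y)) ^ 2) :
    (∫⁻ x, f x) * (∫⁻ x, g x) ≤ (∫⁻ x, h x) ^ 2 := by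
  induction n with
  | zero =>
    have hvol : (volume : Measure (Fin 0 → ℝ)) Set.univ = 1 := by simp [volume_pi]
    simp only [lintegral_unique, hvol, mul_one]
    convert H default default using 3
  | succ n ih =>
    have hmarg : ∀ {k : (Fin (n + 1) → ℝ) → ℝ≥0∞}, Measurable k →
        Measurable fun s : ℝ => ∫⁻ z : Fin n → ℝ, k (Fin.cons s z) := fun hk =>
      (hk.comp measurable_fin_cons).lintegral_prod_right'
    have hslice : ∀ {k : (Fin (n + 1) → ℝ) → ℝ≥0∞}, Measurable k → ∀ s : ℝ,
        Measurable fun z : Fin n → ℝ => k (Fin.cons s z) := fun hk s =>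
      (hk.comp measurable_fin_cons).comp measurable_prodMk_left
    rw [lintegral_fin_cons hf, lintegral_fin_cons hg, lintegral_fin_cons hh]
    refine prekopa_leindler_real (hmarg hf) (hmarg hg) (hmarg hh) fun s t => ?_
    refine ih (hslice hf s) (hslice hg t) (hslice hh _) fun x y => ?_
    convert H (Fin.cons s x) (Fin.cons t y) using 3
    ext i
    refine Fin.cases ?_ (fun j => ?_) i <;> simp [mul_add]

/-- The midpoint Prékopa–Leindler inequality on Euclidean space. -/
theorem prekopa_leindler {n : ℕ} {f g h : EuclideanSpace ℝ (Fin n) → ℝ≥0∞} (hf : Measurable f)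
    (hg : Measurable g) (hh : Measurable h)
    (H : ∀ x y, f x * g y ≤ h ((2⁻¹ : ℝ) • (x + y)) ^ 2) :
    (∫⁻ x, f x) * (∫⁻ x, g x) ≤ (∫⁻ x, h x) ^ 2 := by
  have e := PiLp.volume_preserving_toLp (Fin n)
  rw [← e.lintegral_comp hf, ← e.lintegral_comp hg, ← e.lintegral_comp hh]
  exact prekopa_leindler_pi (hf.comp e.measurable) (hg.comp e.measurable) (hh.comp e.measurable)
    fun x y => H _ _

section Convex

variable {E : Type*} [NormedAddCommGroup E] [NormedSpace ℝ E] {V : E → ℝ}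

lemma ConvexOn.continuous_of_univ [FiniteDimensional ℝ E] (hV : ConvexOn ℝ Set.univ V) :
    Continuous V :=
  continuousOn_univ.1 (hV.continuousOn isOpen_univ)

lemma ConvexOn.map_half_smul_add_le (hV : ConvexOn ℝ Set.univ V) (x y : E) :
    V ((2⁻¹ : ℝ) • (x + y)) ≤ (V x + V y) / 2 := by
  have h := hV.2 (Set.mem_univ x) (Set.mem_univ y)
    (by norm_num : (0 : ℝ) ≤ 2⁻¹) (by norm_num : (0 : ℝ) ≤ 2⁻¹) (by norm_num)
  rw [smul_add]
  simp only [smul_eq_mul] at h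
  linarith

end Convex

lemma tendsto_setIntegral_compl_ball_zero {E : Type*} [NormedAddCommGroup E] [MeasurableSpace E]
    [BorelSpace E] {μ : Measure E} {f : E → ℝ} (hf : Integrable f μ) :
    Filter.Tendsto (fun N : ℕ => ∫ x in (Metric.ball (0 : E) N)ᶜ, f x ∂μ) Filter.atTop
      (nhds 0) := by
  have h := tendsto_setIntegral_of_antitone (μ := μ) (f := f)
    (s := fun N : ℕ => (Metric.ball (0 : E) N)ᶜ) (fun N => measurableSet_ball.compl)
    (fun M N hMN => Set.compl_subset_compl.2 (Metric.ball_subset_ball (by exact_mod_cast hMN)))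
    ⟨0, hf.integrableOn⟩
  rwa [← Set.compl_iUnion, Metric.iUnion_ball_nat, Set.compl_univ, setIntegral_empty] at h

section LogConcaveMoments

variable {E : Type*} [NormedAddCommGroup E] [NormedSpace ℝ E] [FiniteDimensional ℝ E]
  [MeasurableSpace E] [BorelSpace E] {μ : Measure E} [μ.IsAddHaarMeasure] {V : E → ℝ}

/-- A convex potential of an integrable density is coercive. -/
lemma ConvexOn.coercive_of_integrable_exp_neg (hV : ConvexOn ℝ Set.univ V)
    (hint : Integrable (fun x => Real.exp (-V x)) μ) (C : ℝ) :
    ∃ R : ℝ, ∀ x, R ≤ ‖x‖ → C ≤ V x := by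
  have hcont := hV.continuous_of_univ
  obtain ⟨M, hM⟩ := (isCompact_closedBall (0 : E) 1).bddAbove_image hcont.continuousOn
  have hM' : ∀ w : E, ‖w‖ ≤ 1 → V w ≤ M := fun w hw =>
    hM (Set.mem_image_of_mem _ (by simpa using hw))
  have hpos : 0 < μ.real (Metric.ball (0 : E) (1 / 2)) * Real.exp (-((C + M) / 2)) :=
    mul_pos (ENNReal.toReal_pos (Metric.measure_ball_pos μ _ (by norm_num)).ne'
      measure_ball_lt_top.ne) (Real.exp_pos _)
  obtain ⟨N, hN⟩ := ((tendsto_setIntegral_compl_ball_zero hint).eventually_lt_const hpos).exists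
  refine ⟨2 * N + 1, fun y hy => ?_⟩
  by_contra! hlt
  refine absurd hN (not_lt.2 ?_)
  have hsub : Metric.ball ((2⁻¹ : ℝ) • y) (1 / 2) ⊆ (Metric.ball (0 : E) N)ᶜ := by
    intro z hz
    simp only [Metric.mem_ball, dist_eq_norm, Set.mem_compl_iff, sub_zero, not_lt] at hz ⊢
    have h1 : ‖(2⁻¹ : ℝ) • y‖ = ‖y‖ / 2 := by
      rw [norm_smul]; norm_num; ring
    have h2 := norm_sub_norm_le ((2⁻¹ : ℝ) • y) z
    rw [norm_sub_rev] at h2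
    linarith
  calc μ.real (Metric.ball (0 : E) (1 / 2)) * Real.exp (-((C + M) / 2))
      = ∫ _ in Metric.ball ((2⁻¹ : ℝ) • y) (1 / 2), Real.exp (-((C + M) / 2)) ∂μ := by
        rw [setIntegral_const, smul_eq_mul, Measure.real, Measure.real,
          Measure.addHaar_ball_center μ ((2⁻¹ : ℝ) • y)]
    _ ≤ ∫ z in Metric.ball ((2⁻¹ : ℝ) • y) (1 / 2), Real.exp (-V z) ∂μ := by
        refine setIntegral_mono_on (integrableOn_const measure_ball_lt_top.ne) hint.integrableOn
          measurableSet_ball fun z hz => Real.exp_le_exp.2 (neg_le_neg ?_)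
        have hw : ‖(2 : ℝ) • z - y‖ ≤ 1 := by
          have : (2 : ℝ) • z - y = (2 : ℝ) • (z - (2⁻¹ : ℝ) • y) := by
            rw [smul_sub, smul_smul]; norm_num
          rw [this, norm_smul, ← dist_eq_norm]
          have := Metric.mem_ball.1 hz
          norm_num
          linarith
        have h := hV.map_half_smul_add_le y ((2 : ℝ) • z - y)
        rw [add_sub_cancel, smul_smul, inv_mul_cancel₀ two_ne_zero, one_smul] at h
        linarith [hM' _ hw]
    _ ≤ ∫ z in (Metric.ball (0 : E) N)ᶜ, Real.exp (-V z) ∂μ :=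
        setIntegral_mono_set hint.integrableOn (ae_of_all _ fun z => (Real.exp_pos _).le)
          hsub.eventuallyLE

/-- A convex potential of an integrable density grows at least linearly. -/
lemma ConvexOn.exists_linear_growth (hV : ConvexOn ℝ Set.univ V)
    (hint : Integrable (fun x => Real.exp (-V x)) μ) :
    ∃ a > 0, ∃ b, ∀ x, a * ‖x‖ - b ≤ V x := by
  obtain ⟨R₀, hR₀⟩ := hV.coercive_of_integrable_exp_neg hint (V 0 + 1)
  set R := max R₀ 1
  have hR : 0 < R := lt_max_of_lt_right one_pos
  obtain ⟨m, hm⟩ := (isCompact_closedBall (0 : E) R).bddBelow_image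
    hV.continuous_of_univ.continuousOn
  refine ⟨R⁻¹, inv_pos.2 hR, max (-V 0) (1 - m), fun x => ?_⟩
  rcases le_or_gt ‖x‖ R with hx | hx
  · have h1 : m ≤ V x := hm (Set.mem_image_of_mem _ (by simpa using hx))
    have h2 : R⁻¹ * ‖x‖ ≤ 1 := by
      rw [inv_mul_le_iff₀ hR]; simpa using hx
    linarith [le_max_right (-V 0) (1 - m)]
  · have hx0 : 0 < ‖x‖ := hR.trans hx
    set s := R / ‖x‖
    have hs : 0 < s := div_pos hR hx0
    have hs1 : s ≤ 1 := (div_le_one hx0).2 hx.le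
    have hnorm : ‖s • x‖ = R := by
      rw [norm_smul, Real.norm_of_nonneg hs.le, div_mul_cancel₀ _ hx0.ne']
    have h1 := hR₀ (s • x) (by rw [hnorm]; exact le_max_left _ _)
    have h2 := hV.2 (Set.mem_univ x) (Set.mem_univ 0) hs.le (sub_nonneg.2 hs1)
      (add_sub_cancel _ _)
    simp only [smul_zero, add_zero, smul_eq_mul] at h2
    have h3 : 1 ≤ s * (V x - V 0) := by linarith
    have h4 : R⁻¹ * ‖x‖ ≤ V x - V 0 := by
      have : R⁻¹ * ‖x‖ = 1 / s := by simp only [s]; field_simp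
      rw [this, div_le_iff₀ hs]
      linarith
    linarith [le_max_left (-V 0) (1 - m)]

/-- A log-concave density has finite second moment. -/
lemma ConvexOn.integrable_norm_sub_sq_mul_exp_neg (hV : ConvexOn ℝ Set.univ V)
    (hint : Integrable (fun x => Real.exp (-V x)) μ) (c : E) :
    Integrable (fun x => ‖x - c‖ ^ 2 * Real.exp (-V x)) μ := by
  have hcont := hV.continuous_of_univ
  obtain ⟨a, ha, b, hab⟩ := hV.exists_linear_growth hint
  have hhalf : Integrable (fun x => Real.exp (-V x / 2)) μ := by
    have hscale : Integrable (fun x => Real.exp (-V ((2⁻¹ : ℝ) • x))) μ :=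
      hint.comp_smul (by norm_num)
    refine (hscale.const_mul (Real.exp (V 0 / 2))).mono' (by fun_prop) (ae_of_all _ fun x => ?_)
    rw [Real.norm_of_nonneg (Real.exp_pos _).le, ← Real.exp_add, Real.exp_le_exp]
    have h := hV.map_half_smul_add_le x 0
    rw [add_zero] at h
    linarith
  have hmaj := (hhalf.const_mul (16 / a ^ 2 * Real.exp (b / 2))).add
    (hint.const_mul (2 * ‖c‖ ^ 2))
  refine hmaj.mono' (by fun_prop) (ae_of_all _ fun x => ?_)
  rw [Real.norm_of_nonneg (by positivity)]
  have h1 : ‖x - c‖ ^ 2 ≤ 2 * ‖x‖ ^ 2 + 2 * ‖c‖ ^ 2 := by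
    have := norm_sub_le x c
    nlinarith [norm_nonneg (x - c), sq_nonneg (‖x‖ - ‖c‖)]
  have h2 : ‖x‖ ^ 2 * Real.exp (-V x) ≤ 8 / a ^ 2 * Real.exp (b / 2) * Real.exp (-V x / 2) := by
    have h3 : (a * ‖x‖ / 2) ^ 2 / 2 ≤ Real.exp ((V x + b) / 2) := by
      have h4 : 0 ≤ a * ‖x‖ / 2 := by positivity
      have h5 := Real.quadratic_le_exp_of_nonneg h4
      have h6 : Real.exp (a * ‖x‖ / 2) ≤ Real.exp ((V x + b) / 2) :=
        Real.exp_le_exp.2 (by linarith [hab x])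
      linarith
    have h7 : ‖x‖ ^ 2 ≤ 8 / a ^ 2 * Real.exp ((V x + b) / 2) := by
      calc ‖x‖ ^ 2 = 8 / a ^ 2 * ((a * ‖x‖ / 2) ^ 2 / 2) := by field_simp; norm_num
        _ ≤ _ := by gcongr
    calc ‖x‖ ^ 2 * Real.exp (-V x)
        ≤ 8 / a ^ 2 * Real.exp ((V x + b) / 2) * Real.exp (-V x) := by gcongr
      _ = _ := by
        rw [mul_assoc, mul_assoc, ← Real.exp_add, ← Real.exp_add]
        ring_nf
  calc ‖x - c‖ ^ 2 * Real.exp (-V x)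
      ≤ (2 * ‖x‖ ^ 2 + 2 * ‖c‖ ^ 2) * Real.exp (-V x) := by gcongr
    _ = 2 * (‖x‖ ^ 2 * Real.exp (-V x)) + 2 * ‖c‖ ^ 2 * Real.exp (-V x) := by ring
    _ ≤ 2 * (8 / a ^ 2 * Real.exp (b / 2) * Real.exp (-V x / 2)) +
        2 * ‖c‖ ^ 2 * Real.exp (-V x) := by gcongr
    _ = _ := by simp only [Pi.add_apply]; ring

end LogConcaveMoments

lemma Real.exp_le_one_add_add_sq_mul_exp_abs (u : ℝ) :
    Real.exp u ≤ 1 + u + u ^ 2 * Real.exp |u| := by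
  have h1 : Real.exp u ≤ 1 + u * Real.exp u := by
    have h := mul_le_mul_of_nonneg_right (Real.add_one_le_exp (-u)) (Real.exp_pos u).le
    rw [← Real.exp_add, neg_add_cancel, Real.exp_zero] at h
    linarith
  rcases le_total 0 u with hu | hu
  · rw [abs_of_nonneg hu]
    nlinarith
  · have h2 := Real.add_one_le_exp u
    have h3 : 1 ≤ Real.exp |u| := Real.one_le_exp (abs_nonneg u)
    nlinarith [sq_nonneg u]

/-- A midpoint log-concavity recursion towards `w` along dyadic steps, together with an upper bound
that is quadratic in the step, forces `z 0 ≤ w`. -/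
lemma le_of_sq_recursion {z : ℕ → ℝ} {w K : ℝ} (hz : ∀ k, 0 < z k) (hw : 0 < w)
    (hrec : ∀ k, w * z k ≤ z (k + 1) ^ 2) (hup : ∀ k, z k ≤ w + ((2⁻¹ : ℝ) ^ k) ^ 2 * K) :
    z 0 ≤ w := by
  have hlog : ∀ k, Real.log (z 0 / w) ≤ 2 ^ k * Real.log (z k / w) := by
    intro k
    induction k with
    | zero => simp
    | succ k ih =>
      have h : z k / w ≤ (z (k + 1) / w) ^ 2 := by
        rw [div_pow, div_le_div_iff₀ hw (by positivity)]
        nlinarith [hrec k]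
      have h' := Real.log_le_log (div_pos (hz k) hw) h
      rw [Real.log_pow] at h'
      calc _ ≤ 2 ^ k * Real.log (z k / w) := ih
        _ ≤ 2 ^ k * (2 * Real.log (z (k + 1) / w)) := by gcongr; exact_mod_cast h'
        _ = _ := by ring
  have hbound : ∀ k : ℕ, Real.log (z 0 / w) ≤ (2⁻¹ : ℝ) ^ k * (K / w) := by
    intro k
    refine (hlog k).trans ?_
    have h1 : Real.log (z k / w) ≤ ((2⁻¹ : ℝ) ^ k) ^ 2 * (K / w) := by
      refine (Real.log_le_sub_one_of_pos (div_pos (hz k) hw)).trans ?_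
      rw [div_sub_one hw.ne', ← mul_div_assoc]
      gcongr
      linarith [hup k]
    calc 2 ^ k * Real.log (z k / w) ≤ 2 ^ k * (((2⁻¹ : ℝ) ^ k) ^ 2 * (K / w)) := by gcongr
      _ = (2 ^ k * (2⁻¹ : ℝ) ^ k) * ((2⁻¹ : ℝ) ^ k * (K / w)) := by ring
      _ = _ := by rw [← mul_pow]; norm_num
  have hlim : Filter.Tendsto (fun k : ℕ => (2⁻¹ : ℝ) ^ k * (K / w)) Filter.atTop (nhds 0) := by
    simpa using (tendsto_pow_atTop_nhds_zero_of_lt_one (r := (2⁻¹ : ℝ)) (by norm_num)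
      (by norm_num)).mul_const (K / w)
  have h0 := ge_of_tendsto' hlim hbound
  by_contra! hcon
  exact absurd h0 (not_le.2 (Real.log_pos ((one_lt_div hw).2 hcon)))

section Reweighting

variable {n : ℕ} {V : EuclideanSpace ℝ (Fin n) → ℝ} {δ : ℝ}

lemma integrable_gaussian_mul_exp_neg (hV : ConvexOn ℝ Set.univ V)
    (hint : Integrable fun x => Real.exp (-V x)) (hδ : 0 < δ) (c : EuclideanSpace ℝ (Fin n)) :
    Integrable fun x => Real.exp (-(δ * ‖x - c‖ ^ 2 / 2)) * Real.exp (-V x) := by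
  have hcont := hV.continuous_of_univ
  refine hint.mono' (by fun_prop) (ae_of_all _ fun x => ?_)
  rw [Real.norm_of_nonneg (by positivity)]
  refine mul_le_of_le_one_left (Real.exp_pos _).le (Real.exp_le_one_iff.2 ?_)
  have : 0 ≤ δ * ‖x - c‖ ^ 2 / 2 := by positivity
  linarith

/-- Midpoint log-concavity of the Gaussian convolution of a log-concave density. -/
lemma reweighted_mass_mul_le_sq (hV : ConvexOn ℝ Set.univ V)
    (hint : Integrable fun x => Real.exp (-V x)) (hδ : 0 < δ) (p q : EuclideanSpace ℝ (Fin n)) :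
    (∫ x, Real.exp (-(δ * ‖x - p‖ ^ 2 / 2)) * Real.exp (-V x)) *
      (∫ x, Real.exp (-(δ * ‖x - q‖ ^ 2 / 2)) * Real.exp (-V x)) ≤
    (∫ x, Real.exp (-(δ * ‖x - (2⁻¹ : ℝ) • (p + q)‖ ^ 2 / 2)) * Real.exp (-V x)) ^ 2 := by
  have hcont := hV.continuous_of_univ
  have hnn : ∀ c x : EuclideanSpace ℝ (Fin n),
      0 ≤ Real.exp (-(δ * ‖x - c‖ ^ 2 / 2)) * Real.exp (-V x) := fun c x => by positivity
  have hnn' : ∀ c : EuclideanSpace ℝ (Fin n),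
      0 ≤ ∫ x, Real.exp (-(δ * ‖x - c‖ ^ 2 / 2)) * Real.exp (-V x) :=
    fun c => integral_nonneg (hnn c)
  rw [← ENNReal.ofReal_le_ofReal_iff (by positivity), ENNReal.ofReal_mul (hnn' p),
    ENNReal.ofReal_pow (hnn' _)]
  simp_rw [ofReal_integral_eq_lintegral_ofReal (integrable_gaussian_mul_exp_neg hV hint hδ _)
    (ae_of_all _ (hnn _))]
  refine prekopa_leindler (by fun_prop) (by fun_prop) (by fun_prop) fun x y => ?_
  rw [← ENNReal.ofReal_mul (hnn p x), ← ENNReal.ofReal_pow (hnn _ _)]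
  refine ENNReal.ofReal_le_ofReal ?_
  rw [← Real.exp_add, ← Real.exp_add, ← Real.exp_add, ← Real.exp_add, ← Real.exp_nat_mul,
    Real.exp_le_exp]
  have h1 := hV.map_half_smul_add_le x y
  have h2 : ‖(2⁻¹ : ℝ) • (x + y) - (2⁻¹ : ℝ) • (p + q)‖ ≤ (‖x - p‖ + ‖y - q‖) / 2 := by
    have : (2⁻¹ : ℝ) • (x + y) - (2⁻¹ : ℝ) • (p + q) = (2⁻¹ : ℝ) • ((x - p) + (y - q)) := by
      module
    rw [this, norm_smul]
    have := norm_add_le (x - p) (y - q)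
    norm_num
    linarith
  have h3 : 2 * ‖(2⁻¹ : ℝ) • (x + y) - (2⁻¹ : ℝ) • (p + q)‖ ^ 2 ≤
      ‖x - p‖ ^ 2 + ‖y - q‖ ^ 2 := by
    nlinarith [norm_nonneg ((2⁻¹ : ℝ) • (x + y) - (2⁻¹ : ℝ) • (p + q)),
      sq_nonneg (‖x - p‖ - ‖y - q‖)]
  have h4 := mul_le_mul_of_nonneg_left h3 hδ.le
  push_cast
  linarith

/-- Pointwise expansion of a shifted Gaussian, to first order in the shift. -/
lemma exp_neg_norm_sub_sq_le {E : Type*} [NormedAddCommGroup E] [InnerProductSpace ℝ E]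
    (hδ : 0 < δ) (y v : E) {ε : ℝ} (hε : 0 ≤ ε) (hε1 : ε ≤ 1) :
    Real.exp (-(δ * ‖y - ε • v‖ ^ 2 / 2)) ≤
      Real.exp (-(δ * ‖y‖ ^ 2 / 2)) * (1 + δ * ε * inner ℝ v y) +
        ε ^ 2 * (2 * (δ * ‖v‖) ^ 2 * Real.exp ((δ * ‖v‖ + 1) ^ 2 / (2 * δ))) := by
  set κ := δ * ‖v‖
  set t := ‖y‖
  set u := δ * ε * inner ℝ v y
  have hκ : 0 ≤ κ := by positivity
  have ht : 0 ≤ t := norm_nonneg _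
  have hu : |u| ≤ ε * (κ * t) := by
    have h := abs_real_inner_le_norm v y
    calc |u| = δ * ε * |inner ℝ v y| := by
          rw [abs_mul, abs_of_nonneg (by positivity : 0 ≤ δ * ε)]
      _ ≤ δ * ε * (‖v‖ * ‖y‖) := by gcongr
      _ = _ := by simp only [κ, t]; ring
  have hu1 : |u| ≤ κ * t := hu.trans (mul_le_of_le_one_left (by positivity) hε1)
  have hsq : u ^ 2 ≤ (ε * (κ * t)) ^ 2 := by
    rw [← sq_abs]; gcongr
  have hexpand : -(δ * ‖y - ε • v‖ ^ 2 / 2) ≤ -(δ * t ^ 2 / 2) + u := by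
    rw [norm_sub_sq_real, real_inner_smul_right, real_inner_comm]
    have : 0 ≤ δ * ‖ε • v‖ ^ 2 := by positivity
    simp only [u, t]
    linarith
  have htt : t ^ 2 ≤ 2 * Real.exp t := by
    linarith [Real.quadratic_le_exp_of_nonneg ht]
  have hquad : -(δ * t ^ 2 / 2) + (t + κ * t) ≤ (κ + 1) ^ 2 / (2 * δ) := by
    rw [le_div_iff₀ (by positivity)]
    nlinarith [sq_nonneg (δ * t - (κ + 1))]
  have hrem : Real.exp (-(δ * t ^ 2 / 2)) * (u ^ 2 * Real.exp |u|) ≤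
      ε ^ 2 * (2 * κ ^ 2 * Real.exp ((κ + 1) ^ 2 / (2 * δ))) :=
    calc Real.exp (-(δ * t ^ 2 / 2)) * (u ^ 2 * Real.exp |u|)
        ≤ Real.exp (-(δ * t ^ 2 / 2)) * ((ε * (κ * t)) ^ 2 * Real.exp (κ * t)) := by gcongr
      _ = ε ^ 2 * (κ ^ 2 * (Real.exp (-(δ * t ^ 2 / 2)) * (t ^ 2 * Real.exp (κ * t)))) := by ring
      _ ≤ ε ^ 2 * (κ ^ 2 * (Real.exp (-(δ * t ^ 2 / 2)) *
            (2 * Real.exp t * Real.exp (κ * t)))) := by gcongr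
      _ = ε ^ 2 * (2 * κ ^ 2 * Real.exp (-(δ * t ^ 2 / 2) + (t + κ * t))) := by
          rw [Real.exp_add, Real.exp_add]; ring
      _ ≤ _ := by gcongr
  calc Real.exp (-(δ * ‖y - ε • v‖ ^ 2 / 2))
      ≤ Real.exp (-(δ * t ^ 2 / 2)) * Real.exp u := by
        rw [← Real.exp_add]; exact Real.exp_le_exp.2 hexpand
    _ ≤ Real.exp (-(δ * t ^ 2 / 2)) * (1 + u + u ^ 2 * Real.exp |u|) := by
        gcongr; exact Real.exp_le_one_add_add_sq_mul_exp_abs u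
    _ ≤ _ := by rw [mul_add]; linarith

lemma reweighted_mass_shift_le (hV : ConvexOn ℝ Set.univ V)
    (hint : Integrable fun x => Real.exp (-V x)) (hδ : 0 < δ)
    {m : EuclideanSpace ℝ (Fin n)}
    (hm : (∫ x, (Real.exp (-(δ * ‖x - m‖ ^ 2 / 2)) * Real.exp (-V x)) • x) =
      (∫ x, Real.exp (-(δ * ‖x - m‖ ^ 2 / 2)) * Real.exp (-V x)) • m)
    (v : EuclideanSpace ℝ (Fin n)) {ε : ℝ} (hε : 0 ≤ ε) (hε1 : ε ≤ 1) :
    (∫ x, Real.exp (-(δ * ‖x - (m + ε • v)‖ ^ 2 / 2)) * Real.exp (-V x)) ≤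
      (∫ x, Real.exp (-(δ * ‖x - m‖ ^ 2 / 2)) * Real.exp (-V x)) +
        ε ^ 2 * (2 * (δ * ‖v‖) ^ 2 * Real.exp ((δ * ‖v‖ + 1) ^ 2 / (2 * δ)) *
          ∫ x, Real.exp (-V x)) := by
  have hcont := hV.continuous_of_univ
  set W : EuclideanSpace ℝ (Fin n) → ℝ :=
    fun x => Real.exp (-(δ * ‖x - m‖ ^ 2 / 2)) * Real.exp (-V x)
  set K := 2 * (δ * ‖v‖) ^ 2 * Real.exp ((δ * ‖v‖ + 1) ^ 2 / (2 * δ))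
  have hW : Integrable W := integrable_gaussian_mul_exp_neg hV hint hδ m
  have hWle : ∀ x, W x ≤ Real.exp (-V x) := fun x => by
    refine mul_le_of_le_one_left (Real.exp_pos _).le (Real.exp_le_one_iff.2 ?_)
    have : 0 ≤ δ * ‖x - m‖ ^ 2 / 2 := by positivity
    linarith
  have hWc : Continuous W := by fun_prop
  have hWx : Integrable fun x => W x • (x - m) := by
    refine (hint.add (hV.integrable_norm_sub_sq_mul_exp_neg hint m)).mono' (by fun_prop)
      (ae_of_all _ fun x => ?_)
    have hW0 : 0 ≤ W x := by positivity
    rw [norm_smul, Real.norm_of_nonneg hW0]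
    calc W x * ‖x - m‖ ≤ Real.exp (-V x) * (1 + ‖x - m‖ ^ 2) := by
          gcongr
          · exact hWle x
          · nlinarith [sq_nonneg (‖x - m‖ - 1), sq_nonneg ‖x - m‖]
      _ = _ := by simp only [Pi.add_apply]; ring
  have hcenter : ∫ x, W x • (x - m) = 0 := by
    have hsplit : ∀ x, W x • x = W x • (x - m) + W x • m := fun x => by
      rw [← smul_add, sub_add_cancel]
    have hm' : ∫ x, W x • x = (∫ x, W x) • m := hm
    simp_rw [hsplit] at hm'
    rwa [integral_add hWx (hW.smul_const m), integral_smul_const, add_eq_right] at hm'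
  have hinner : Integrable fun x => inner ℝ v (W x • (x - m)) := hWx.const_inner v
  have hinner0 : ∫ x, inner ℝ v (W x • (x - m)) = 0 := by
    rw [integral_inner hWx, hcenter, inner_zero_right]
  calc (∫ x, Real.exp (-(δ * ‖x - (m + ε • v)‖ ^ 2 / 2)) * Real.exp (-V x))
      ≤ ∫ x, (W x + δ * ε * inner ℝ v (W x • (x - m))) + ε ^ 2 * K * Real.exp (-V x) := by
        refine integral_mono (integrable_gaussian_mul_exp_neg hV hint hδ _)
          ((hW.add (hinner.const_mul _)).add (hint.const_mul _)) fun x => ?_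
        have h := mul_le_mul_of_nonneg_right
          (exp_neg_norm_sub_sq_le hδ (x - m) v hε hε1) (Real.exp_pos (-V x)).le
        rw [sub_sub] at h
        refine h.trans_eq ?_
        simp only [real_inner_smul_right, W, K]
        ring
    _ = (∫ x, W x) + ε ^ 2 * (K * ∫ x, Real.exp (-V x)) := by
        have hadd : Integrable fun x => W x + δ * ε * inner ℝ v (W x • (x - m)) :=
          hW.add (hinner.const_mul _)
        rw [integral_add hadd (hint.const_mul _),
          integral_add hW (hinner.const_mul _), integral_const_mul, integral_const_mul, hinner0]
        ring

lemma reweighted_mass_pos (hV : ConvexOn ℝ Set.univ V)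
    (hint : Integrable fun x => Real.exp (-V x)) (hδ : 0 < δ) (c : EuclideanSpace ℝ (Fin n)) :
    0 < ∫ x, Real.exp (-(δ * ‖x - c‖ ^ 2 / 2)) * Real.exp (-V x) := by
  simp_rw [← Real.exp_add]
  refine integral_exp_pos ?_
  simpa only [Real.exp_add] using integrable_gaussian_mul_exp_neg hV hint hδ c

/-- The fixed point of the reweighted barycenter map maximizes the reweighted mass. -/
lemma reweighted_mass_le_of_fixed_point (hV : ConvexOn ℝ Set.univ V)
    (hint : Integrable fun x => Real.exp (-V x)) (hδ : 0 < δ)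
    {m : EuclideanSpace ℝ (Fin n)}
    (hm : (∫ x, (Real.exp (-(δ * ‖x - m‖ ^ 2 / 2)) * Real.exp (-V x)) • x) =
      (∫ x, Real.exp (-(δ * ‖x - m‖ ^ 2 / 2)) * Real.exp (-V x)) • m)
    (c : EuclideanSpace ℝ (Fin n)) :
    (∫ x, Real.exp (-(δ * ‖x - c‖ ^ 2 / 2)) * Real.exp (-V x)) ≤
      ∫ x, Real.exp (-(δ * ‖x - m‖ ^ 2 / 2)) * Real.exp (-V x) := by
  have h := le_of_sq_recursion
    (z := fun k : ℕ => ∫ x, Real.exp (-(δ * ‖x - (m + (2⁻¹ : ℝ) ^ k • (c - m))‖ ^ 2 / 2)) *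
      Real.exp (-V x))
    (fun k => reweighted_mass_pos hV hint hδ _) (reweighted_mass_pos hV hint hδ m)
    (fun k => by
      refine (reweighted_mass_mul_le_sq hV hint hδ m _).trans_eq ?_
      have : (2⁻¹ : ℝ) • (m + (m + (2⁻¹ : ℝ) ^ k • (c - m))) =
          m + (2⁻¹ : ℝ) ^ (k + 1) • (c - m) := by
        rw [pow_succ]; module
      rw [this])
    (fun k => reweighted_mass_shift_le hV hint hδ hm (c - m) (by positivity)
      (pow_le_one₀ (by norm_num) (by norm_num)))
  simpa using h

/-- Jensen's inequality for the exponential reweighting. -/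
lemma exp_neg_variance_le_reweighted_mass (hV : ConvexOn ℝ Set.univ V)
    (hρ : (∫ x, Real.exp (-V x)) = 1) (hint : Integrable fun x => Real.exp (-V x)) (hδ : 0 < δ)
    (c : EuclideanSpace ℝ (Fin n)) :
    Real.exp (-(δ / 2 * ∫ x, ‖x - c‖ ^ 2 * Real.exp (-V x))) ≤
      ∫ x, Real.exp (-(δ * ‖x - c‖ ^ 2 / 2)) * Real.exp (-V x) := by
  have hmom := hV.integrable_norm_sub_sq_mul_exp_neg hint c
  set s := δ / 2 * ∫ x, ‖x - c‖ ^ 2 * Real.exp (-V x) with hs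
  calc Real.exp (-s)
      = ∫ x, Real.exp (-s) * (1 + s) * Real.exp (-V x) -
          Real.exp (-s) * (δ / 2) * (‖x - c‖ ^ 2 * Real.exp (-V x)) := by
        rw [integral_sub (hint.const_mul _) (hmom.const_mul _), integral_const_mul,
          integral_const_mul, hρ, mul_assoc _ (δ / 2), ← hs]
        ring
    _ ≤ _ := by
        refine integral_mono ((hint.const_mul _).sub (hmom.const_mul _))
          (integrable_gaussian_mul_exp_neg hV hint hδ c) fun x => ?_
        have h := Real.add_one_le_exp (s - δ * ‖x - c‖ ^ 2 / 2)
        have h' : Real.exp (-s) * (s - δ * ‖x - c‖ ^ 2 / 2 + 1) ≤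
            Real.exp (-(δ * ‖x - c‖ ^ 2 / 2)) := by
          calc _ ≤ Real.exp (-s) * Real.exp (s - δ * ‖x - c‖ ^ 2 / 2) := by gcongr
            _ = _ := by rw [← Real.exp_add]; ring_nf
        refine (le_of_eq ?_).trans (mul_le_mul_of_nonneg_right h' (Real.exp_pos (-V x)).le)
        ring

end Reweighting

/-- **Simple lower bound on the reweighted mass at the fixed point.**
For a log-concave probability density `ρ = e^{-V}` on `ℝⁿ` and `δ > 0`, with `m_δ` the
fixed point of the reweighted barycenter map and `Var(ρ) = inf_c ∫ |x-c|² ρ(x) dx`,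
`-log(∫ e^{-δ|x-m_δ|²/2} ρ(x) dx) ≤ (δ/2) Var(ρ)`. -/
theorem reweighted_mass_simple_bound
    {n : ℕ} (V : EuclideanSpace ℝ (Fin n) → ℝ) (hV : ConvexOn ℝ Set.univ V)
    (hρ : (∫ x, Real.exp (-V x)) = 1)
    (δ : ℝ) (hδ : 0 < δ)
    (mδ : EuclideanSpace ℝ (Fin n))
    (hmδ : (∫ x, (Real.exp (-(δ * ‖x - mδ‖ ^ 2 / 2)) * Real.exp (-V x)) • x) =
      (∫ x, Real.exp (-(δ * ‖x - mδ‖ ^ 2 / 2)) * Real.exp (-V x)) • mδ) :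
    -Real.log (∫ x, Real.exp (-(δ * ‖x - mδ‖ ^ 2 / 2)) * Real.exp (-V x)) ≤
      δ / 2 * ⨅ c : EuclideanSpace ℝ (Fin n), ∫ x, ‖x - c‖ ^ 2 * Real.exp (-V x) := by
  have hint : Integrable fun x => Real.exp (-V x) :=
    Integrable.of_integral_ne_zero (by rw [hρ]; exact one_ne_zero)
  rw [Real.mul_iInf_of_nonneg (by positivity)]
  refine le_ciInf fun c => ?_
  rw [neg_le, Real.le_log_iff_exp_le (reweighted_mass_pos hV hint hδ mδ)]
  exact (exp_neg_variance_le_reweighted_mass hV hρ hint hδ c).trans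
    (reweighted_mass_le_of_fixed_point hV hint hδ hmδ c)
end

section
/- Let ρ = e^{−V} be a probability density on ℝⁿ with V : ℝⁿ → ℝ convex, and for δ > 0 let m_δ be the unique point satisfying ∫ x e^{−δ|x−m_δ|²/2} ρ(x) dx = m_δ ∫ e^{−δ|x−m_δ|²/2} ρ(x) dx, let μ_δ be the probability measure with density proportional to e^{−δ|x−m_δ|²/2} ρ(x), and set g(δ) := −log( ∫ e^{−δ|x−m_δ|²/2} ρ(x) dx ). Then for all δ, δ' > 0: g(δ') − g(δ) ≤ ((δ'−δ)/2)·∫ |x−m_δ|² dμ_δ(x) + δ'·|m_δ − m_{δ'}|². -/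
open MeasureTheory

/-- A Gaussian weight keeps second moments finite against an integrable function. -/
lemma integrable_gaussian_mul_norm_sub_sq {n : ℕ} {ρ : EuclideanSpace ℝ (Fin n) → ℝ}
    (hρ : Integrable ρ) {δ : ℝ} (hδ : 0 < δ) (a : EuclideanSpace ℝ (Fin n)) :
    Integrable (fun x => Real.exp (-(δ * ‖x - a‖ ^ 2 / 2)) * ρ x * ‖x - a‖ ^ 2) := by
  have hb : ∀ x, ‖‖x - a‖ ^ 2 * Real.exp (-(δ * ‖x - a‖ ^ 2 / 2))‖ ≤ 2 / δ := fun x => by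
    have h₁ := Real.add_one_le_exp (δ * ‖x - a‖ ^ 2 / 2)
    rw [Real.norm_of_nonneg (by positivity), Real.exp_neg, ← div_eq_mul_inv,
      div_le_div_iff₀ (Real.exp_pos _) hδ]
    linarith
  refine (hρ.bdd_mul (Continuous.aestronglyMeasurable (by fun_prop))
    (Filter.Eventually.of_forall hb)).congr (Filter.Eventually.of_forall fun x => ?_)
  ring

/-- A Gaussian weight preserves integrability. -/
lemma integrable_gaussian_mul {n : ℕ} {ρ : EuclideanSpace ℝ (Fin n) → ℝ}
    (hρ : Integrable ρ) {δ : ℝ} (hδ : 0 < δ) (a : EuclideanSpace ℝ (Fin n)) :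
    Integrable (fun x => Real.exp (-(δ * ‖x - a‖ ^ 2 / 2)) * ρ x) := by
  refine hρ.bdd_mul (c := 1) (Continuous.aestronglyMeasurable (by fun_prop))
    (Filter.Eventually.of_forall fun x => ?_)
  rw [Real.norm_of_nonneg (Real.exp_pos _).le, Real.exp_le_one_iff]
  have : 0 ≤ δ * ‖x - a‖ ^ 2 / 2 := by positivity
  linarith

/-- A weight with finite mass and second moment about `a` has a first moment about `a`. -/
lemma integrable_smul_sub_of_sq {n : ℕ} {w : EuclideanSpace ℝ (Fin n) → ℝ}
    {a : EuclideanSpace ℝ (Fin n)} (hw : Integrable w)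
    (hw₂ : Integrable (fun x => w x * ‖x - a‖ ^ 2)) :
    Integrable (fun x => w x • (x - a)) := by
  refine (hw.norm.add hw₂.norm).mono' (hw.1.smul (Continuous.aestronglyMeasurable (by fun_prop)))
    (Filter.Eventually.of_forall fun x => ?_)
  simp only [Pi.add_apply, norm_smul, norm_mul, norm_pow, norm_norm]
  nlinarith [norm_nonneg (w x), mul_nonneg (norm_nonneg (w x)) (sq_nonneg (‖x - a‖ - 1)),
    mul_nonneg (norm_nonneg (w x)) (sq_nonneg ‖x - a‖)]

/-- Jensen's inequality for the exponential and an unnormalised weight. -/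
lemma log_integral_add_le_log_integral_mul_exp {α : Type*} [MeasurableSpace α] {ν : Measure α}
    {w T : α → ℝ} (hw₀ : ∀ x, 0 ≤ w x) (hw : Integrable w ν) (hZ : 0 < ∫ x, w x ∂ν)
    (hwT : Integrable (fun x => w x * T x) ν)
    (hexp : Integrable (fun x => w x * Real.exp (T x)) ν) :
    Real.log (∫ x, w x ∂ν) + (∫ x, w x * T x ∂ν) / (∫ x, w x ∂ν) ≤
      Real.log (∫ x, w x * Real.exp (T x) ∂ν) := by
  set Z := ∫ x, w x ∂ν
  set A := (∫ x, w x * T x ∂ν) / Z with hA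
  have hAZ : ∫ x, w x * T x ∂ν = A * Z := by rw [hA]; field_simp
  have hle : ∫ x, Real.exp A * ((1 - A) * w x + w x * T x) ∂ν ≤
      ∫ x, w x * Real.exp (T x) ∂ν := by
    refine integral_mono (((hw.const_mul _).add hwT).const_mul _) hexp fun x => ?_
    have h := mul_le_mul_of_nonneg_left (Real.add_one_le_exp (T x - A))
      (mul_nonneg (hw₀ x) (Real.exp_pos A).le)
    have h' : Real.exp A * Real.exp (T x - A) = Real.exp (T x) := by
      rw [← Real.exp_add]; ring_nf
    rw [mul_assoc, mul_assoc, h'] at h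
    refine le_trans (le_of_eq ?_) h
    ring
  rw [integral_const_mul, integral_add (hw.const_mul _) hwT, integral_const_mul, hAZ] at hle
  have hle' : Z * Real.exp A ≤ ∫ x, w x * Real.exp (T x) ∂ν := by
    refine le_trans (le_of_eq ?_) hle
    ring
  calc Real.log Z + A = Real.log (Z * Real.exp A) := by
        rw [Real.log_mul hZ.ne' (Real.exp_pos _).ne', Real.log_exp]
    _ ≤ _ := Real.log_le_log (by positivity) hle'

/-- **An increment bound for `g(δ) = -log ∫ e^{-δ|x-m_δ|²/2} ρ`.**
For a log-concave probability density `ρ = e^{-V}` on `ℝⁿ`, with `m δ` the fixed point of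
the reweighted barycenter map for each `δ > 0` and `μ_δ` the probability measure with
density proportional to `e^{-δ|x-m_δ|²/2} ρ(x)`, one has for all `δ, δ' > 0`:
`g(δ') - g(δ) ≤ ((δ'-δ)/2) ∫ |x-m_δ|² dμ_δ + δ' |m_δ - m_{δ'}|²`. -/
theorem g_increment_bound
    {n : ℕ} (V : EuclideanSpace ℝ (Fin n) → ℝ) (hV : ConvexOn ℝ Set.univ V)
    (hρ : (∫ x, Real.exp (-V x)) = 1)
    (m : ℝ → EuclideanSpace ℝ (Fin n))
    (hm : ∀ δ > (0 : ℝ),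
      (∫ x, (Real.exp (-(δ * ‖x - m δ‖ ^ 2 / 2)) * Real.exp (-V x)) • x) =
        (∫ x, Real.exp (-(δ * ‖x - m δ‖ ^ 2 / 2)) * Real.exp (-V x)) • m δ)
    (Z : ℝ → ℝ)
    (hZ : ∀ δ, Z δ = ∫ x, Real.exp (-(δ * ‖x - m δ‖ ^ 2 / 2)) * Real.exp (-V x))
    (g : ℝ → ℝ) (hg : ∀ δ, g δ = -Real.log (Z δ))
    (μ : ℝ → Measure (EuclideanSpace ℝ (Fin n)))
    (hμ : ∀ δ, μ δ = volume.withDensity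
      (fun x => ENNReal.ofReal (Real.exp (-(δ * ‖x - m δ‖ ^ 2 / 2)) * Real.exp (-V x) / Z δ)))
    (δ δ' : ℝ) (hδ : 0 < δ) (hδ' : 0 < δ') :
    g δ' - g δ ≤ (δ' - δ) / 2 * (∫ x, ‖x - m δ‖ ^ 2 ∂(μ δ)) + δ' * ‖m δ - m δ'‖ ^ 2 := by
  have hρi : Integrable (fun x => Real.exp (-V x)) :=
    Integrable.of_integral_ne_zero (by rw [hρ]; exact one_ne_zero)
  set w : EuclideanSpace ℝ (Fin n) → ℝ :=
    fun x => Real.exp (-(δ * ‖x - m δ‖ ^ 2 / 2)) * Real.exp (-V x) with hw_def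
  have hw_pos : ∀ x, 0 < w x := fun x => by positivity
  have hw : Integrable w := integrable_gaussian_mul hρi hδ (m δ)
  have hw₂ : Integrable (fun x => w x * ‖x - m δ‖ ^ 2) :=
    integrable_gaussian_mul_norm_sub_sq hρi hδ (m δ)
  have hw₁ : Integrable (fun x => w x • (x - m δ)) := integrable_smul_sub_of_sq hw hw₂
  have hZδ : Z δ = ∫ x, w x := hZ δ
  have hZpos : 0 < ∫ x, w x := by
    rw [integral_pos_iff_support_of_nonneg (fun x => (hw_pos x).le) hw,
      Function.support_eq_univ fun x => (hw_pos x).ne']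
    exact Measure.measure_univ_pos.2 (NeZero.ne _)
  have hmean : ∫ x, w x • (x - m δ) = 0 := by
    have hwx : Integrable (fun x => w x • x) := by
      refine (hw₁.add (hw.smul_const (m δ))).congr (Filter.Eventually.of_forall fun x => ?_)
      simp [smul_sub]
    simp_rw [smul_sub]
    rw [integral_sub hwx (hw.smul_const _), integral_smul_const, sub_eq_zero]
    exact hm δ hδ
  set c := m δ - m δ'
  have hcross_int : Integrable (fun x => inner ℝ c (w x • (x - m δ))) := hw₁.const_inner c
  have hcross : ∫ x, inner ℝ c (w x • (x - m δ)) = 0 := by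
    rw [integral_inner hw₁, hmean, inner_zero_right]
  have hμint : ∫ x, ‖x - m δ‖ ^ 2 ∂(μ δ) = (∫ x, w x * ‖x - m δ‖ ^ 2) / ∫ x, w x := by
    rw [hμ, integral_withDensity_eq_integral_toReal_smul₀
      (hw.1.aemeasurable.div_const _).ennreal_ofReal
      (Filter.Eventually.of_forall fun x => ENNReal.ofReal_lt_top), ← integral_div]
    refine integral_congr_ae (Filter.Eventually.of_forall fun x => ?_)
    have h₀ : 0 ≤ w x / Z δ := div_nonneg (hw_pos x).le (hZδ ▸ hZpos.le)
    simp only [smul_eq_mul]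
    rw [ENNReal.toReal_ofReal h₀, hZδ]
    ring
  set T : EuclideanSpace ℝ (Fin n) → ℝ :=
    fun x => δ * ‖x - m δ‖ ^ 2 / 2 - δ' * ‖x - m δ'‖ ^ 2 / 2 with hT_def
  have hwT : ∀ x, w x * T x = (δ - δ') / 2 * (w x * ‖x - m δ‖ ^ 2)
      - δ' * inner ℝ c (w x • (x - m δ)) - δ' * ‖c‖ ^ 2 / 2 * w x := fun x => by
    have hx : ‖x - m δ'‖ ^ 2 = ‖x - m δ‖ ^ 2 + 2 * inner ℝ c (x - m δ) + ‖c‖ ^ 2 := by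
      rw [← sub_add_sub_cancel x (m δ) (m δ'), norm_add_sq_real, real_inner_comm]
    simp only [hT_def]
    rw [hx, inner_smul_right]
    ring
  have hdiff_int : Integrable (fun x => (δ - δ') / 2 * (w x * ‖x - m δ‖ ^ 2)
      - δ' * inner ℝ c (w x • (x - m δ))) := (hw₂.const_mul _).sub (hcross_int.const_mul _)
  have hwT_int : Integrable (fun x => w x * T x) := by
    simp_rw [hwT]
    exact hdiff_int.sub (hw.const_mul _)
  have hwT_eq : ∫ x, w x * T x =
      (δ - δ') / 2 * (∫ x, w x * ‖x - m δ‖ ^ 2) - δ' * ‖c‖ ^ 2 / 2 * ∫ x, w x := by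
    simp_rw [hwT]
    rw [integral_sub hdiff_int (hw.const_mul _),
      integral_sub (hw₂.const_mul _) (hcross_int.const_mul _), integral_const_mul,
      integral_const_mul, integral_const_mul, hcross, mul_zero, sub_zero]
  have hexp : ∀ x, w x * Real.exp (T x) =
      Real.exp (-(δ' * ‖x - m δ'‖ ^ 2 / 2)) * Real.exp (-V x) := fun x => by
    simp only [hw_def, hT_def]
    rw [← Real.exp_add, ← Real.exp_add, ← Real.exp_add]
    ring_nf
  have hJ := log_integral_add_le_log_integral_mul_exp (fun x => (hw_pos x).le) hw hZpos hwT_int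
    (by simp_rw [hexp]; exact integrable_gaussian_mul hρi hδ' (m δ'))
  simp_rw [hexp] at hJ
  rw [← hZ δ', hwT_eq, sub_div, mul_div_assoc, mul_div_assoc _ (∫ x, w x),
    div_self hZpos.ne'] at hJ
  rw [hg, hg, hZδ, hμint]
  have : 0 ≤ δ' * ‖c‖ ^ 2 := by positivity
  linarith
end
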